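/- arXiv:2109.03639 — 2 statements merged into one kernel-verified Lean document; each statement's English description precedes it below -/
import Mathlib

section
/- Let R be an m×m real symmetric matrix, let λ denote its largest eigenvalue, and set R̃ = R − λ·I_m, which is negative semidefinite. Fix ρ > 0, a matrix E ∈ ℝ^{m×n}, a point Y_τ ∈ ℝ^{m×n}, and an arbitrary function f from n×n real matrices to ℝ. Define A = E − ρ·R̃·Y_τ. Then for every Y ∈ ℝ^{m×n}: f((YᵀY)⁻¹) + (ρ/2)·Tr(Yᵀ R Y) − Tr(Eᵀ Y) ≤ f((YᵀY)⁻¹) + (ρ/2)·λ·Tr(Yᵀ Y) − Tr(Aᵀ Y) − (ρ/2)·Tr(Y_τᵀ R̃ Y_τ), and equality holds when Y = Y_τ. -/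
open Matrix

theorem aux_nsd {m : ℕ} (R : Matrix (Fin m) (Fin m) ℝ) (hR : R.IsHermitian)
    (lam : ℝ) (h : ∀ i, hR.eigenvalues i ≤ lam) :
    (lam • (1 : Matrix (Fin m) (Fin m) ℝ) - R).PosSemidef := by
  have hU : (hR.eigenvectorUnitary : Matrix (Fin m) (Fin m) ℝ) *
      (hR.eigenvectorUnitary : Matrix (Fin m) (Fin m) ℝ)ᴴ = 1 :=
    Unitary.coe_mul_star_self hR.eigenvectorUnitary
  have hs : R = (hR.eigenvectorUnitary : Matrix (Fin m) (Fin m) ℝ) *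
      diagonal hR.eigenvalues * (hR.eigenvectorUnitary : Matrix (Fin m) (Fin m) ℝ)ᴴ := by
    have := hR.spectral_theorem
    rw [Unitary.conjStarAlgAut_apply] at this
    exact this
  have hd : (diagonal (fun i => lam - hR.eigenvalues i)).PosSemidef :=
    PosSemidef.diagonal (fun i => sub_nonneg.2 (h i))
  have := hd.mul_mul_conjTranspose_same (hR.eigenvectorUnitary : Matrix (Fin m) (Fin m) ℝ)
  convert this using 1
  have e : diagonal (fun i => lam - hR.eigenvalues i) =
      lam • (1 : Matrix (Fin m) (Fin m) ℝ) - diagonal hR.eigenvalues := by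
    rw [smul_one_eq_diagonal, diagonal_sub]
  rw [e, mul_sub, sub_mul, ← hs, mul_smul_comm, mul_one, smul_mul_assoc, hU]

/-- the MM majorization bound (Lemma 4 of the paper). `lam` is the largest
eigenvalue of the symmetric matrix `R`; `R - lam • 1` is negative semidefinite, and the
surrogate upper-bounds the objective with equality at `Y = Yτ`. -/
theorem stmt_0 {m n : ℕ} (ρ : ℝ) (hρ : 0 < ρ)
    (R : Matrix (Fin m) (Fin m) ℝ) (hR : R.IsHermitian)
    (lam : ℝ) (hlam_ub : ∀ i, hR.eigenvalues i ≤ lam)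
    (hlam_mem : ∃ i, hR.eigenvalues i = lam)
    (E Yτ : Matrix (Fin m) (Fin n) ℝ)
    (f : Matrix (Fin n) (Fin n) ℝ → ℝ)
    (Rt : Matrix (Fin m) (Fin m) ℝ) (hRt : Rt = R - lam • (1 : Matrix (Fin m) (Fin m) ℝ))
    (A : Matrix (Fin m) (Fin n) ℝ) (hA : A = E - ρ • (Rt * Yτ)) :
    (∀ x : Fin m → ℝ, x ⬝ᵥ (Rt *ᵥ x) ≤ 0) ∧
    (∀ Y : Matrix (Fin m) (Fin n) ℝ,
      f ((Yᵀ * Y)⁻¹) + ρ / 2 * Matrix.trace (Yᵀ * R * Y) - Matrix.trace (Eᵀ * Y) ≤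
        f ((Yᵀ * Y)⁻¹) + ρ / 2 * lam * Matrix.trace (Yᵀ * Y)
          - Matrix.trace (Aᵀ * Y) - ρ / 2 * Matrix.trace (Yτᵀ * Rt * Yτ)) ∧
    (f ((Yτᵀ * Yτ)⁻¹) + ρ / 2 * Matrix.trace (Yτᵀ * R * Yτ) - Matrix.trace (Eᵀ * Yτ) =
      f ((Yτᵀ * Yτ)⁻¹) + ρ / 2 * lam * Matrix.trace (Yτᵀ * Yτ)
        - Matrix.trace (Aᵀ * Yτ) - ρ / 2 * Matrix.trace (Yτᵀ * Rt * Yτ)) := by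
  have hP := aux_nsd R hR lam hlam_ub
  have hneg : lam • (1 : Matrix (Fin m) (Fin m) ℝ) - R = -Rt := by rw [hRt]; abel
  rw [hneg] at hP
  have hRtT : Rtᵀ = Rt := by
    have := hP.1
    rw [IsHermitian, conjTranspose_eq_transpose_of_trivial, transpose_neg] at this
    exact neg_injective this
  have hRe : R = Rt + lam • (1 : Matrix (Fin m) (Fin m) ℝ) := by rw [hRt]; abel
  have h1 : ∀ Y : Matrix (Fin m) (Fin n) ℝ, trace (Yᵀ * R * Y) =
      trace (Yᵀ * Rt * Y) + lam * trace (Yᵀ * Y) := by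
    intro Y
    rw [hRe]
    simp [mul_add, Matrix.mul_add, Matrix.add_mul, trace_add]
  have h2 : ∀ Y : Matrix (Fin m) (Fin n) ℝ, trace (Aᵀ * Y) =
      trace (Eᵀ * Y) - ρ * trace (Yτᵀ * Rt * Y) := by
    intro Y
    rw [hA]
    simp [Matrix.sub_mul, trace_sub, transpose_mul, hRtT]
  refine ⟨?_, ?_, ?_⟩
  · intro x
    have := hP.dotProduct_mulVec_nonneg x
    simpa [neg_mulVec] using this
  · intro Y
    have h3 := (hP.conjTranspose_mul_mul_same (Y - Yτ)).trace_nonneg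
    have h4 : trace (Yᵀ * Rt * Yτ) = trace (Yτᵀ * Rt * Y) := by
      rw [← trace_transpose]
      simp [transpose_mul, hRtT, Matrix.mul_assoc]
    simp only [conjTranspose_eq_transpose_of_trivial, transpose_sub, Matrix.sub_mul,
      Matrix.mul_sub, Matrix.mul_neg, Matrix.neg_mul, trace_sub, trace_neg, h4] at h3
    rw [h1, h2]
    nlinarith [mul_nonneg hρ.le h3]
  · rw [h1, h2]
    ring
end

section
/- Let m ≥ n ≥ 1, let c > 0, and let A ∈ ℝ^{m×n} be given with a singular value decomposition A = U Σ Vᵀ, where U ∈ ℝ^{m×m} and V ∈ ℝ^{n×n} are orthogonal matrices and Σ ∈ ℝ^{m×n} is zero off its main diagonal with diagonal entries σ₁ ≥ σ₂ ≥ … ≥ σ_n ≥ 0. Consider g_A(Y) = Tr((YᵀY)⁻¹) + (c/2)·Tr(YᵀY) − Tr(AᵀY) over the set of Y ∈ ℝ^{m×n} with YᵀY invertible. Then g_A attains a global minimum on this set, and it has a global minimizer of the form Y = U Λ Vᵀ, where Λ ∈ ℝ^{m×n} is zero off its main diagonal and its i-th diagonal entry γ̂ᵢ > 0 is a global minimizer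 of γ ↦ γ⁻² + (c/2)·γ² − σᵢ·γ over (0,∞). -/
open Matrix

/-- The A-optimality ADMM–MM subproblem objective
`g_A(Y) = Tr((YᵀY)⁻¹) + (c/2)·Tr(YᵀY) − Tr(AᵀY)`. -/
noncomputable def gA {m n : ℕ} (c : ℝ) (A Y : Matrix (Fin m) (Fin n) ℝ) : ℝ :=
  Matrix.trace ((Yᵀ * Y)⁻¹) + c / 2 * Matrix.trace (Yᵀ * Y) - Matrix.trace (Aᵀ * Y)

theorem aux_scalar (c s : ℝ) (hc : 0 < c) (hs : 0 ≤ s) :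
    ∃ g : ℝ, 0 < g ∧ ∀ x : ℝ, 0 < x →
      (g ^ 2)⁻¹ + c / 2 * g ^ 2 - s * g ≤ (x ^ 2)⁻¹ + c / 2 * x ^ 2 - s * x := by
  set f : ℝ → ℝ := fun x => (x ^ 2)⁻¹ + c / 2 * x ^ 2 - s * x with hf
  set L : ℝ := 1 + c / 2 + s ^ 2 / (2 * c) with hL
  have hLpos : 0 < L := by positivity
  set a : ℝ := (1 + L)⁻¹ with ha
  set b : ℝ := 1 + 2 * (s + 1 + c / 2) / c with hb
  have ha0 : 0 < a := by positivity
  have ha1 : a ≤ 1 := inv_le_one_of_one_le₀ (by linarith)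
  have hb1 : 1 ≤ b := by
    have : 0 ≤ 2 * (s + 1 + c / 2) / c := by positivity
    linarith
  have hcont : ContinuousOn f (Set.Icc a b) := by
    have h1 : ContinuousOn (fun x : ℝ => (x ^ 2)⁻¹) (Set.Icc a b) := by
      apply ContinuousOn.inv₀ (by fun_prop)
      intro x hx
      have : 0 < x := lt_of_lt_of_le ha0 hx.1
      positivity
    exact (h1.add (by fun_prop)).sub (by fun_prop)
  obtain ⟨g, hg, hmin⟩ := isCompact_Icc.exists_isMinOn ⟨1, ha1, hb1⟩ hcont
  have hg1 : f g ≤ f 1 := hmin (show (1:ℝ) ∈ Set.Icc a b from ⟨ha1, hb1⟩)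
  have hf1 : f 1 ≤ 1 + c / 2 := by simp only [hf]; norm_num; exact hs
  refine ⟨g, lt_of_lt_of_le ha0 hg.1, fun x hx => ?_⟩
  change f g ≤ f x
  by_cases hxa : x < a
  · have h1 : 1 + L ≤ x⁻¹ := by
      rw [← inv_inv (1 + L)]
      exact inv_anti₀ hx hxa.le
    have h2 : L ≤ (x ^ 2)⁻¹ := by
      rw [← inv_pow]; nlinarith
    have h3 : -(s ^ 2 / (2 * c)) ≤ c / 2 * x ^ 2 - s * x := by
      have : c / 2 * x ^ 2 - s * x + s ^ 2 / (2 * c) = (c * x - s) ^ 2 / (2 * c) := by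
        field_simp; ring
      have h4 : 0 ≤ (c * x - s) ^ 2 / (2 * c) := by positivity
      linarith
    have : 1 + c / 2 ≤ f x := by simp only [hf]; linarith
    linarith
  · by_cases hxb : x ≤ b
    · exact hmin (show x ∈ Set.Icc a b from ⟨not_lt.mp hxa, hxb⟩)
    · push Not at hxb
      have h1 : c / 2 * b = c / 2 + (s + 1 + c / 2) := by
        simp only [hb]; field_simp
      have h2 : c / 2 * b ≤ c / 2 * x := by gcongr
      have h3 : 0 < (x ^ 2)⁻¹ := by positivity
      have : 1 + c / 2 ≤ f x := by simp only [hf]; nlinarith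
      linarith

theorem aux_gA {m n : ℕ} (c : ℝ) (U : Matrix (Fin m) (Fin m) ℝ) (V : Matrix (Fin n) (Fin n) ℝ)
    (hU : Uᵀ * U = 1) (hV : Vᵀ * V = 1) (S W : Matrix (Fin m) (Fin n) ℝ) :
    gA c (U * S * Vᵀ) (U * W * Vᵀ) = gA c S W := by
  have key : ∀ P Q : Matrix (Fin m) (Fin n) ℝ,
      (U * P * Vᵀ)ᵀ * (U * Q * Vᵀ) = V * (Pᵀ * Q) * Vᵀ := by
    intro P Q
    simp only [Matrix.transpose_mul, Matrix.transpose_transpose, Matrix.mul_assoc]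
    rw [← Matrix.mul_assoc Uᵀ U, hU, Matrix.one_mul]
  have tr : ∀ X : Matrix (Fin n) (Fin n) ℝ, (V * X * Vᵀ).trace = X.trace := by
    intro X
    rw [Matrix.trace_mul_comm, ← Matrix.mul_assoc, hV, Matrix.one_mul]
  have hVi : V⁻¹ = Vᵀ := Matrix.inv_eq_left_inv hV
  have hVi2 : Vᵀ⁻¹ = V := Matrix.inv_eq_right_inv hV
  unfold gA
  rw [key, key, tr, tr, Matrix.mul_inv_rev, Matrix.mul_inv_rev, hVi, hVi2, ← Matrix.mul_assoc, tr]

theorem aux_det {m n : ℕ} (U : Matrix (Fin m) (Fin m) ℝ) (V : Matrix (Fin n) (Fin n) ℝ)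
    (hU : Uᵀ * U = 1) (hV : Vᵀ * V = 1) (W : Matrix (Fin m) (Fin n) ℝ) :
    ((U * W * Vᵀ)ᵀ * (U * W * Vᵀ)).det = (Wᵀ * W).det := by
  have key : (U * W * Vᵀ)ᵀ * (U * W * Vᵀ) = V * (Wᵀ * W) * Vᵀ := by
    simp only [Matrix.transpose_mul, Matrix.transpose_transpose, Matrix.mul_assoc]
    rw [← Matrix.mul_assoc Uᵀ U, hU, Matrix.one_mul]
  rw [key, Matrix.det_mul_comm, ← Matrix.mul_assoc, hV, Matrix.one_mul]

theorem aux_diag {m n : ℕ} (hmn : n ≤ m) (s : Fin n → ℝ) (S W : Matrix (Fin m) (Fin n) ℝ)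
    (hS : ∀ i j, S i j = if (i : ℕ) = (j : ℕ) then s j else 0) (i j : Fin n) :
    (Sᵀ * W) i j = s i * W (Fin.castLE hmn i) j := by
  rw [Matrix.mul_apply, Finset.sum_eq_single (Fin.castLE hmn i)]
  · simp [hS]
  · intro k _ hk
    have : (k : ℕ) ≠ (i : ℕ) := fun h => hk (Fin.ext h)
    simp [hS, this]
  · simp

theorem aux_lower {m n : ℕ} (hmn : n ≤ m) (c : ℝ) (s : Fin n → ℝ) (hs0 : ∀ i, 0 ≤ s i)
    (S W : Matrix (Fin m) (Fin n) ℝ)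
    (hS : ∀ i j, S i j = if (i : ℕ) = (j : ℕ) then s j else 0)
    (hW : IsUnit (Wᵀ * W).det) (t : Fin n → ℝ)
    (ht : ∀ i, ∀ x : ℝ, 0 < x → t i ≤ (x ^ 2)⁻¹ + c / 2 * x ^ 2 - s i * x) :
    ∑ i, t i ≤ gA c S W := by
  have : gA c S W = ∑ i, (((Wᵀ * W)⁻¹) i i + c / 2 * (Wᵀ * W) i i - (Sᵀ * W) i i) := by
    unfold gA
    simp only [Matrix.trace, Matrix.diag, Finset.sum_sub_distrib, Finset.sum_add_distrib,
      Finset.mul_sum]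
  rw [this]
  refine Finset.sum_le_sum fun i _ => ?_
  set M := Wᵀ * W with hM
  have hMT : Mᵀ = M := by simp [hM]
  have hMii : M i i = ∑ k, W k i ^ 2 := by
    simp [hM, Matrix.mul_apply, sq]
  set X := W * M⁻¹ with hX
  have hXW : Xᵀ * W = 1 := by
    rw [hX, Matrix.transpose_mul, Matrix.transpose_nonsing_inv, hMT, Matrix.mul_assoc, ← hM,
      Matrix.nonsing_inv_mul _ hW]
  have hXX : Xᵀ * X = M⁻¹ := by
    conv_lhs => rw [hX, ← Matrix.mul_assoc, ← hX, hXW, Matrix.one_mul]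
  have hXii : M⁻¹ i i = ∑ k, X k i ^ 2 := by
    rw [← hXX]; simp [Matrix.mul_apply, sq]
  have h1 : ∑ k, X k i * W k i = 1 := by
    have := congrFun (congrFun hXW i) i
    simpa [Matrix.mul_apply] using this
  have hCS := Finset.sum_mul_sq_le_sq_mul_sq Finset.univ (fun k => X k i) (fun k => W k i)
  simp only [h1, ← hXii, ← hMii] at hCS
  have hM0 : 0 ≤ M i i := by rw [hMii]; positivity
  have hMpos : 0 < M i i := by
    rcases hM0.lt_or_eq with h | h
    · exact h
    · rw [← h] at hCS; norm_num at hCS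
  have hinv : (M i i)⁻¹ ≤ M⁻¹ i i := by
    rw [inv_le_iff_one_le_mul₀ hMpos]; linarith
  rw [aux_diag hmn s S W hS]
  have hle : W (Fin.castLE hmn i) i ≤ √(M i i) := by
    apply Real.le_sqrt_of_sq_le
    rw [hMii]
    exact Finset.single_le_sum (f := fun k => W k i ^ 2) (fun k _ => sq_nonneg _)
      (Finset.mem_univ _)
  have h2 := ht i (√(M i i)) (Real.sqrt_pos.mpr hMpos)
  rw [Real.sq_sqrt hM0] at h2
  have h3 := mul_le_mul_of_nonneg_left hle (hs0 i)
  linarith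

/-- given an SVD `A = U Σ Vᵀ` with nonincreasing nonnegative singular values
`σᵢ`, the objective `g_A` attains a global minimum over `{Y : YᵀY invertible}`, and it has a
global minimizer of the form `Y = U Λ Vᵀ` where `Λ` is zero off its main diagonal and its
`i`-th diagonal entry `γᵢ > 0` is a global minimizer of `γ ↦ γ⁻² + (c/2)γ² − σᵢ γ` on
`(0,∞)`. -/
theorem stmt_13 {m n : ℕ} (hn : 1 ≤ n) (hmn : n ≤ m) (c : ℝ) (hc : 0 < c)
    (U : Matrix (Fin m) (Fin m) ℝ) (V : Matrix (Fin n) (Fin n) ℝ)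
    (hU : Uᵀ * U = 1) (hV : Vᵀ * V = 1)
    (σ : Fin n → ℝ) (hσ0 : ∀ i, 0 ≤ σ i) (hσdec : ∀ i j : Fin n, i ≤ j → σ j ≤ σ i)
    (S : Matrix (Fin m) (Fin n) ℝ)
    (hS : ∀ i j, S i j = if (i : ℕ) = (j : ℕ) then σ j else 0)
    (A : Matrix (Fin m) (Fin n) ℝ) (hA : A = U * S * Vᵀ) :
    (∃ Y : Matrix (Fin m) (Fin n) ℝ, IsUnit (Yᵀ * Y).det ∧
      ∀ Z : Matrix (Fin m) (Fin n) ℝ, IsUnit (Zᵀ * Z).det → gA c A Y ≤ gA c A Z) ∧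
    (∃ (γ : Fin n → ℝ) (Λ : Matrix (Fin m) (Fin n) ℝ),
      (∀ i, 0 < γ i) ∧
      (∀ i, ∀ x : ℝ, 0 < x →
        (γ i ^ 2)⁻¹ + c / 2 * γ i ^ 2 - σ i * γ i ≤ (x ^ 2)⁻¹ + c / 2 * x ^ 2 - σ i * x) ∧
      (∀ i j, Λ i j = if (i : ℕ) = (j : ℕ) then γ j else 0) ∧
      IsUnit (((U * Λ * Vᵀ)ᵀ * (U * Λ * Vᵀ)).det) ∧
      (∀ Z : Matrix (Fin m) (Fin n) ℝ, IsUnit (Zᵀ * Z).det →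
        gA c A (U * Λ * Vᵀ) ≤ gA c A Z)) := by
  choose γ hγ0 hγ using fun i => aux_scalar c (σ i) hc (hσ0 i)
  let Λ : Matrix (Fin m) (Fin n) ℝ :=
    Matrix.of fun i j => if (i : ℕ) = (j : ℕ) then γ j else 0
  have hΛ : ∀ i j, Λ i j = if (i : ℕ) = (j : ℕ) then γ j else 0 := fun i j => rfl
  have hD : Λᵀ * Λ = Matrix.diagonal (fun i => γ i ^ 2) := by
    ext i j
    rw [aux_diag hmn γ Λ Λ hΛ, hΛ, Matrix.diagonal_apply]
    by_cases h : i = j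
    · subst h; simp [sq]
    · have : (i : ℕ) ≠ (j : ℕ) := fun h' => h (Fin.ext h')
      simp [h, this]
  have hUU : U * Uᵀ = 1 := mul_eq_one_comm.mp hU
  have hVV : V * Vᵀ = 1 := mul_eq_one_comm.mp hV
  have hdet : IsUnit (Λᵀ * Λ).det := by
    rw [hD, Matrix.det_diagonal, isUnit_iff_ne_zero]
    exact Finset.prod_ne_zero_iff.mpr fun i _ => (pow_pos (hγ0 i) 2).ne'
  have hval : gA c S Λ = ∑ i, ((γ i ^ 2)⁻¹ + c / 2 * γ i ^ 2 - σ i * γ i) := by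
    have hI : (Λᵀ * Λ)⁻¹ = Matrix.diagonal (fun i => (γ i ^ 2)⁻¹) := by
      apply Matrix.inv_eq_right_inv
      rw [hD, Matrix.diagonal_mul_diagonal, ← Matrix.diagonal_one]
      congr 1
      funext i
      exact mul_inv_cancel₀ (pow_pos (hγ0 i) 2).ne'
    have hT : Matrix.trace (Sᵀ * Λ) = ∑ i, σ i * γ i := by
      simp only [Matrix.trace, Matrix.diag]
      refine Finset.sum_congr rfl fun i _ => ?_
      rw [aux_diag hmn σ S Λ hS, hΛ]; simp
    unfold gA
    rw [hI, hT, hD, Matrix.trace_diagonal, Matrix.trace_diagonal, Finset.sum_sub_distrib,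
      Finset.sum_add_distrib, Finset.mul_sum]
  have hdet' : IsUnit (((U * Λ * Vᵀ)ᵀ * (U * Λ * Vᵀ)).det) := by
    rw [aux_det U V hU hV]; exact hdet
  have hmin : ∀ Z : Matrix (Fin m) (Fin n) ℝ, IsUnit (Zᵀ * Z).det →
      gA c A (U * Λ * Vᵀ) ≤ gA c A Z := by
    intro Z hZ
    have hZW : Z = U * (Uᵀ * Z * V) * Vᵀ := by
      rw [Matrix.mul_assoc Uᵀ, ← Matrix.mul_assoc U, hUU, Matrix.one_mul, Matrix.mul_assoc, hVV,
        Matrix.mul_one]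
    generalize Uᵀ * Z * V = W at hZW
    subst hZW
    rw [aux_det U V hU hV] at hZ
    rw [hA, aux_gA c U V hU hV, aux_gA c U V hU hV, hval]
    exact aux_lower hmn c σ hσ0 S W hS hZ _ hγ
  exact ⟨⟨_, hdet', hmin⟩, γ, Λ, hγ0, hγ, hΛ, hdet', hmin⟩
end
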